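/- Let f(x) = ax² + bx + c be a quadratic polynomial with integer coefficients a, b, c such that a > 0 and 4a + b² − 4ac ≥ 1, and let S = {f(x) : x ∈ ℤ}. There exists N₀ such that for every integer N ≥ N₀ the following holds: if a₀ is a non-negative integer and a₁, …, a_d are positive integers (not necessarily distinct) such that every element of the Hilbert cube H(a₀; a₁, …, a_d) lies in S ∩ [1, N], then d ≤ 7 · log log N. -/

import Mathlib

theorem Int.sq_emod_eight_of_odd {x : ℤ} (h : Odd x) : x ^ 2 % 8 = 1 := by
  have := Int.eight_dvd_sq_sub_one_of_odd h
  omega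

theorem Int.sq_emod_four_of_even {x : ℤ} (h : Even x) : x ^ 2 % 4 = 0 := by
  obtain ⟨y, rfl⟩ := h
  ring_nf
  omega

theorem Int.three_dvd_of_sq_add_sq {x y : ℤ} (h : 3 ∣ x ^ 2 + y ^ 2) : 3 ∣ x ∧ 3 ∣ y := by
  have key : ∀ s t : ZMod 3, s ^ 2 + t ^ 2 = 0 → s = 0 ∧ t = 0 := by decide
  have := key x y (by exact_mod_cast (ZMod.intCast_zmod_eq_zero_iff_dvd _ 3).2 h)
  simpa [ZMod.intCast_zmod_eq_zero_iff_dvd _ 3] using this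

/-- The descent step behind Fermat's theorem on four squares in arithmetic progression. -/
theorem exists_concordant_of_mul_eq {p q u v : ℤ} (hpq : IsCoprime p q) (hp : Odd p) (hq : Even q)
    (hq0 : q ≠ 0) (hsum : (3 * u) ^ 2 + v ^ 2 = p ^ 2 + q ^ 2) (hmul : u * v = p * q) :
    ∃ n d e f : ℤ, n ^ 2 = d ^ 2 + e ^ 2 ∧ n ^ 2 = 9 * d ^ 2 + f ^ 2 ∧ d ≠ 0 ∧ n ∣ p := by
  obtain ⟨a, b, ⟨c, rfl⟩, ⟨d, rfl⟩, rfl⟩ := exists_dvd_and_dvd_of_dvd_mul ⟨v, hmul.symm⟩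
  have hb0 : b ≠ 0 := left_ne_zero_of_mul hq0
  obtain ⟨ha, hc⟩ := Int.odd_mul.1 hp
  have ha0 : a ≠ 0 := by rintro rfl; simp at ha
  have hv : v = c * d := by
    apply mul_left_cancel₀ (mul_ne_zero ha0 hb0)
    linear_combination hmul
  subst hv
  have had : IsCoprime a d := hpq.of_mul_left_left.of_mul_right_right
  have hcb : IsCoprime c b := hpq.of_mul_left_right.of_mul_right_left
  have hcd : IsCoprime c d := hpq.of_mul_left_right.of_mul_right_right
  have heq : a ^ 2 * (9 * b ^ 2 - c ^ 2) = d ^ 2 * (b ^ 2 - c ^ 2) := by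
    linear_combination hsum
  obtain ⟨k, hk⟩ : a ^ 2 ∣ b ^ 2 - c ^ 2 :=
    (had.pow (m := 2) (n := 2)).dvd_of_dvd_mul_left ⟨_, heq.symm⟩
  have hk' : 9 * b ^ 2 - c ^ 2 = d ^ 2 * k := by
    apply mul_left_cancel₀ (pow_ne_zero 2 ha0)
    rw [heq, hk]; ring
  have hk8 : k ∣ 8 := by
    have h1 : k ∣ c ^ 2 * 8 := ⟨d ^ 2 - 9 * a ^ 2, by linear_combination hk' - 9 * hk⟩
    have h2 : k ∣ b ^ 2 * 8 := ⟨d ^ 2 - a ^ 2, by linear_combination hk' - hk⟩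
    obtain ⟨r, s, hrs⟩ := hcb.pow (m := 2) (n := 2)
    have : (8 : ℤ) = r * (c ^ 2 * 8) + s * (b ^ 2 * 8) := by linear_combination -8 * hrs
    rw [this]
    exact dvd_add (h1.mul_left _) (h2.mul_left _)
  have hk_le : k ≤ 8 := Int.le_of_dvd (by norm_num) hk8
  have hk_ge : -8 ≤ k := by
    have := Int.le_of_dvd (by norm_num) ((neg_dvd).2 hk8)
    linarith
  have hk_cases : k = 1 ∨ k = -1 ∨ k = 2 ∨ k = -2 ∨ k = 4 ∨ k = -4 ∨ k = 8 ∨ k = -8 := by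
    clear hk hk'
    interval_cases k <;> revert hk8 <;> decide
  have ha8 := Int.sq_emod_eight_of_odd ha
  have hc8 := Int.sq_emod_eight_of_odd hc
  rcases Int.even_or_odd b with hb | hb
  · have hb4 := Int.sq_emod_four_of_even hb
    have hkm : k = -1 := by
      generalize a ^ 2 = A at *
      generalize b ^ 2 = B at *
      generalize c ^ 2 = C at *
      rcases hk_cases with rfl | rfl | rfl | rfl | rfl | rfl | rfl | rfl <;> omega
    subst hkm
    exact ⟨c, b, a, d, by linear_combination -hk, by linear_combination -hk', hb0,
      Dvd.intro_left a rfl⟩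
  · exfalso
    have hd : Even d := by
      rcases Int.even_mul.1 hq with h | h
      · exact absurd h (Int.not_even_iff_odd.2 hb)
      · exact h
    have hb8 := Int.sq_emod_eight_of_odd hb
    have hd4 := Int.sq_emod_four_of_even hd
    have hkm : k = 8 ∨ k = -8 := by
      generalize a ^ 2 = A at *
      generalize b ^ 2 = B at *
      generalize c ^ 2 = C at *
      rcases hk_cases with rfl | rfl | rfl | rfl | rfl | rfl | rfl | rfl <;> omega
    rcases hkm with rfl | rfl
    · generalize a ^ 2 = A at *
      generalize b ^ 2 = B at *
      generalize c ^ 2 = C at *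
      generalize d ^ 2 = D at *
      omega
    · obtain ⟨h1, h2⟩ := Int.three_dvd_of_sq_add_sq (x := c) (y := d)
        ⟨3 * b ^ 2 + 3 * d ^ 2, by linear_combination -hk'⟩
      have := hcd.isUnit_of_dvd' h1 h2
      rw [Int.isUnit_iff] at this
      omega

theorem exists_concordant_of_sq_eq {p q r s : ℤ} (hpq : IsCoprime p q) (hp : Odd p) (hq : Even q)
    (hq0 : q ≠ 0) (hr : r ^ 2 = p ^ 2 + q ^ 2 + 6 * (p * q))
    (hs : s ^ 2 = p ^ 2 + q ^ 2 - 6 * (p * q)) :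
    ∃ n d e f : ℤ, n ^ 2 = d ^ 2 + e ^ 2 ∧ n ^ 2 = 9 * d ^ 2 + f ^ 2 ∧ d ≠ 0 ∧ n ∣ p := by
  have hrs : Even (r + s) := by
    have : Even (r ^ 2 + s ^ 2) := ⟨p ^ 2 + q ^ 2, by linear_combination hr + hs⟩
    simpa [Int.even_add, Int.even_pow] using this
  obtain ⟨u, hu⟩ := hrs
  obtain ⟨v, rfl⟩ : ∃ v, r = u + v := ⟨r - u, by ring⟩
  obtain rfl : s = u - v := by linear_combination hu
  have hmul : u * v = 3 * (p * q) := by linarith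
  have hsum : u ^ 2 + v ^ 2 = p ^ 2 + q ^ 2 := by linarith
  rcases Int.prime_three.dvd_or_dvd ⟨_, hmul⟩ with ⟨w, rfl⟩ | ⟨w, rfl⟩
  · exact exists_concordant_of_mul_eq hpq hp hq hq0 hsum (by linarith)
  · exact exists_concordant_of_mul_eq hpq hp hq hq0 ((add_comm _ _).trans hsum) (by linarith)

/-- `n² - d²` and `n² - 9d²` are both squares only for `d = 0`. -/
theorem eq_zero_of_sq_eq_sq_add_sq_of_sq_eq_nine_mul_sq_add_sq {n d e f : ℤ}
    (h1 : n ^ 2 = d ^ 2 + e ^ 2) (h2 : n ^ 2 = 9 * d ^ 2 + f ^ 2) : d = 0 := by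
  induction hm : n.natAbs using Nat.strong_induction_on generalizing n d e f with
  | _ m ih =>
  subst hm
  by_contra hd0
  have hn0 : n ≠ 0 := by
    rintro rfl
    have : 0 < d ^ 2 := by positivity
    nlinarith [sq_nonneg e]
  by_cases hcop : IsCoprime n d
  swap
  · rw [Int.isCoprime_iff_gcd_eq_one, ← ne_eq, Nat.ne_one_iff_exists_prime_dvd] at hcop
    obtain ⟨p, hp, hpd⟩ := hcop
    obtain ⟨n, rfl⟩ := (Int.natCast_dvd_natCast.2 hpd).trans (Int.gcd_dvd_left n d)
    obtain ⟨d, rfl⟩ := (Int.natCast_dvd_natCast.2 hpd).trans (Int.gcd_dvd_right _ d)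
    have hp0 : (p : ℤ) ≠ 0 := by exact_mod_cast hp.ne_zero
    obtain ⟨e, rfl⟩ : (p : ℤ) ∣ e := (Int.pow_dvd_pow_iff two_ne_zero).1
      ⟨n ^ 2 - d ^ 2, by linear_combination -h1⟩
    obtain ⟨f, rfl⟩ : (p : ℤ) ∣ f := (Int.pow_dvd_pow_iff two_ne_zero).1
      ⟨n ^ 2 - 9 * d ^ 2, by linear_combination -h2⟩
    have hd : d ≠ 0 := right_ne_zero_of_mul hd0
    refine hd (ih n.natAbs ?_ (n := n) (e := e) (f := f) ?_ ?_ rfl)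
    · rw [Int.natAbs_mul]
      have : 0 < n.natAbs := Int.natAbs_pos.2 (right_ne_zero_of_mul hn0)
      have := hp.two_le
      simp only [Int.natAbs_natCast]
      nlinarith
    · apply mul_left_cancel₀ (pow_ne_zero 2 hp0); linear_combination h1
    · apply mul_left_cancel₀ (pow_ne_zero 2 hp0); linear_combination h2
  wlog hn : 0 < n generalizing n
  · exact this (n := -n) (by simpa using h1) (by simpa using h2) (by simpa using ih)
      (by simpa using hn0) hcop.neg_left (by omega)
  have hnd : Odd n ∧ Even d := by
    have hnot2 : ¬ (2 ∣ n ∧ 2 ∣ d) := fun h => by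
      have := hcop.isUnit_of_dvd' h.1 h.2
      rw [Int.isUnit_iff] at this
      omega
    have hn : Odd n := by
      by_contra hn
      rw [Int.not_odd_iff_even] at hn
      have hd : Odd d := by
        by_contra hd
        exact hnot2 ⟨hn.two_dvd, (Int.not_odd_iff_even.1 hd).two_dvd⟩
      have hn4 := Int.sq_emod_four_of_even hn
      have hd8 := Int.sq_emod_eight_of_odd hd
      rcases Int.even_or_odd e with he | he
      · have := Int.sq_emod_four_of_even he
        omega
      · have := Int.sq_emod_eight_of_odd he
        omega
    refine ⟨hn, ?_⟩
    by_contra hd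
    rw [Int.not_even_iff_odd] at hd
    have hn8 := Int.sq_emod_eight_of_odd hn
    have hd8 := Int.sq_emod_eight_of_odd hd
    have four_dvd : ∀ x : ℤ, x ^ 2 % 8 = 0 → ∃ y, x = 4 * y := by
      intro x hx
      rcases Int.even_or_odd' x with ⟨y, rfl | rfl⟩
      · rcases Int.even_or_odd' y with ⟨z, rfl | rfl⟩
        · exact ⟨z, by ring⟩
        · ring_nf at hx
          omega
      · have := Int.sq_emod_eight_of_odd ⟨y, rfl⟩
        omega
    obtain ⟨e, rfl⟩ := four_dvd e (by omega)
    obtain ⟨f, rfl⟩ := four_dvd f (by omega)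
    rw [mul_pow] at h1 h2
    omega
  have hed : Int.gcd e d = 1 := by
    rw [← Int.isCoprime_iff_gcd_eq_one]
    have : IsCoprime (n ^ 2) (d ^ 2) := hcop.pow
    rw [h1] at this
    have h3 : IsCoprime (e ^ 2) (d ^ 2) := by
      have h4 : IsCoprime (e ^ 2 + d ^ 2 * 1) (d ^ 2) := by rwa [mul_one, add_comm]
      exact IsCoprime.add_mul_left_left_iff.1 h4
    exact (IsCoprime.pow_iff two_pos two_pos).1 h3
  have he : Odd e := by
    have : Odd (d ^ 2 + e ^ 2) := h1 ▸ hnd.1.pow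
    rw [Int.odd_add] at this
    have hdd : ¬ Odd (d ^ 2) := by simpa [Int.even_pow] using hnd.2
    by_contra h
    rw [Int.not_odd_iff_even] at h
    exact hdd (this.2 (h.pow_of_ne_zero two_ne_zero))
  have hpyth : PythagoreanTriple e d n := by
    unfold PythagoreanTriple; linear_combination -h1
  obtain ⟨p, q, -, rfl, rfl, hpq, hpar, -⟩ :=
    hpyth.coprime_classification' hed (Int.odd_iff.1 he) hn
  rw [← Int.isCoprime_iff_gcd_eq_one] at hpq
  have h3 : ¬ (3 : ℤ) ∣ p ^ 2 + q ^ 2 := fun h => by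
    obtain ⟨x, hx⟩ := h
    have h3d := (Int.three_dvd_of_sq_add_sq (x := 2 * p * q) (y := p ^ 2 - q ^ 2)
      ⟨3 * x ^ 2, by linear_combination (p ^ 2 + q ^ 2 + 3 * x) * hx⟩).1
    have := hcop.isUnit_of_dvd' ⟨x, hx⟩ h3d
    rw [Int.isUnit_iff] at this
    omega
  have hf0 : f ≠ 0 := by
    rintro rfl
    exact h3 (Int.prime_three.dvd_of_dvd_pow (n := 2)
      ⟨3 * (2 * p * q) ^ 2, by linear_combination h2⟩)
  have hprod : (p ^ 2 + q ^ 2 + 6 * (p * q)) * (p ^ 2 + q ^ 2 - 6 * (p * q)) = f ^ 2 := by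
    linear_combination h2
  have hpos : 0 < p ^ 2 + q ^ 2 + 6 * (p * q) ∧ 0 < p ^ 2 + q ^ 2 - 6 * (p * q) := by
    have : 0 < f ^ 2 := by positivity
    rw [← hprod] at this
    rcases pos_and_pos_or_neg_and_neg_of_mul_pos this with h | h
    · exact h
    · linarith [h.1, h.2]
  have hcop6 : IsCoprime (p ^ 2 + q ^ 2 + 6 * (p * q)) (p ^ 2 + q ^ 2 - 6 * (p * q)) := by
    have c3 : IsCoprime (p ^ 2 + q ^ 2) 3 :=
      ((Int.prime_three.coprime_iff_not_dvd).2 h3).symm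
    have c2 : IsCoprime (p ^ 2 + q ^ 2) 2 := by
      refine ((Int.prime_two.coprime_iff_not_dvd).2 fun h => ?_).symm
      exact Int.not_even_iff_odd.2 hnd.1 (even_iff_two_dvd.2 h)
    have c6 : IsCoprime (p ^ 2 + q ^ 2 - 6 * (p * q)) (3 * (2 * p * q)) := by
      have := IsCoprime.add_mul_left_left (c3.mul_right hcop) (-1)
      rwa [show p ^ 2 + q ^ 2 + 3 * (2 * p * q) * -1 = p ^ 2 + q ^ 2 - 6 * (p * q) by ring] at this
    have c2' : IsCoprime (p ^ 2 + q ^ 2 - 6 * (p * q)) 2 := by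
      have := IsCoprime.add_mul_left_left c2 (-(3 * (p * q)))
      rwa [show p ^ 2 + q ^ 2 + 2 * -(3 * (p * q)) = p ^ 2 + q ^ 2 - 6 * (p * q) by ring] at this
    have := IsCoprime.add_mul_right_right (c2'.mul_right c6) 1
    rw [show 2 * (3 * (2 * p * q)) + 1 * (p ^ 2 + q ^ 2 - 6 * (p * q)) =
      p ^ 2 + q ^ 2 + 6 * (p * q) by ring] at this
    exact this.symm
  obtain ⟨r, hr⟩ := Int.sq_of_isCoprime hcop6 hprod
  obtain ⟨s, hs⟩ := Int.sq_of_isCoprime hcop6.symm ((mul_comm _ _).trans hprod)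
  replace hr : r ^ 2 = p ^ 2 + q ^ 2 + 6 * (p * q) := by
    rcases hr with hr | hr
    · exact hr.symm
    · nlinarith [hpos.1, sq_nonneg r]
  replace hs : s ^ 2 = p ^ 2 + q ^ 2 - 6 * (p * q) := by
    rcases hs with hs | hs
    · exact hs.symm
    · nlinarith [hpos.2, sq_nonneg s]
  have hp0 : p ≠ 0 := by rintro rfl; simp at hd0
  have hq0 : q ≠ 0 := by rintro rfl; simp at hd0
  have small : ∀ {x y n : ℤ}, x ≠ 0 → y ≠ 0 → n ∣ x → n.natAbs < (x ^ 2 + y ^ 2).natAbs := by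
    intro x y n hx hy hnx
    have h1 := Int.natAbs_le_of_dvd_ne_zero hnx hx
    have h2 : 0 < y ^ 2 := by positivity
    have h3 := Int.natAbs_le_self_sq x
    omega
  rcases hpar with ⟨hp2, hq2⟩ | ⟨hp2, hq2⟩
  · obtain ⟨n, d, e, f, h1, h2, h3, h4⟩ := exists_concordant_of_sq_eq hpq.symm (Int.odd_iff.2 hq2)
      (Int.even_iff.2 hp2) hp0 (r := r) (s := s) (by linear_combination hr)
      (by linear_combination hs)
    exact h3 (ih _ (by rw [add_comm]; exact small hq0 hp0 h4) h1 h2 rfl)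
  · obtain ⟨n, d, e, f, h1, h2, h3, h4⟩ := exists_concordant_of_sq_eq hpq (Int.odd_iff.2 hp2)
      (Int.even_iff.2 hq2) hq0 hr hs
    exact h3 (ih _ (small hp0 hq0 h4) h1 h2 rfl)

/-- Fermat: four squares in arithmetic progression are equal. -/
theorem eq_zero_of_four_squares_arith_prog {w x y z t d : ℤ} (h0 : t = w ^ 2)
    (h1 : t + d = x ^ 2) (h2 : t + 2 * d = y ^ 2) (h3 : t + 3 * d = z ^ 2) : d = 0 := by
  refine eq_zero_of_sq_eq_sq_add_sq_of_sq_eq_nine_mul_sq_add_sq (n := 2 * t + 3 * d)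
    (e := 2 * x * y) (f := 2 * w * z) ?_ ?_
  · linear_combination 4 * (t + d) * h2 + 4 * y ^ 2 * h1
  · linear_combination 4 * t * h3 + 4 * z ^ 2 * h0

open Finset in
theorem three_mul_card_le_of_add_mem {A C : Finset ℕ} {a : ℕ} (hAC : A ⊆ C)
    (hAa : ∀ x ∈ A, x + a ∈ C)
    (hC : ∀ x ∈ C, x + a ∈ C → x + 2 * a ∈ C → x + 3 * a ∉ C) : 3 * #A ≤ 2 * #C := by
  have hsub : A ⊆ (C \ A).image (· - a) ∪ (C \ A).image (· - 2 * a) := by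
    intro x hx
    have hx1 := hAa x hx
    simp only [mem_union, mem_image, mem_sdiff]
    by_cases h1 : x + a ∈ A
    · have hx2 := hAa _ h1
      rw [show x + a + a = x + 2 * a by ring] at hx2
      refine .inr ⟨x + 2 * a, ⟨hx2, fun h2 => hC x (hAC hx) hx1 hx2 ?_⟩, by omega⟩
      simpa only [show x + 2 * a + a = x + 3 * a by ring] using hAa _ h2
    · exact .inl ⟨x + a, ⟨hx1, h1⟩, by omega⟩
  have h1 := (card_le_card hsub).trans (card_union_le _ _)
  have h2 := card_image_le (s := C \ A) (f := (· - a))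
  have h3 := card_image_le (s := C \ A) (f := (· - 2 * a))
  have h4 := card_sdiff_add_card_eq_card hAC
  omega

/-- The set of subset sums of the family `A` over `T`. -/
def subsetSums {ι : Type*} (A : ι → ℕ) (T : Finset ι) : Finset ℕ :=
  T.powerset.image fun F => ∑ i ∈ F, A i

theorem mem_subsetSums {ι : Type*} {A : ι → ℕ} {T : Finset ι} {x : ℕ} :
    x ∈ subsetSums A T ↔ ∃ F ⊆ T, ∑ i ∈ F, A i = x := by
  simp [subsetSums]

open Finset in
theorem three_pow_le_card_subsetSums {ι : Type*} {A : ι → ℕ} {T : Finset ι} {S : Set ℕ}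
    (hS : ∀ x a, 0 < a → x ∈ S → x + a ∈ S → x + 2 * a ∈ S → x + 3 * a ∉ S)
    (hA : ∀ i ∈ T, 0 < A i) {t : ℕ} (hT : ∀ F ⊆ T, t + ∑ i ∈ F, A i ∈ S) :
    3 ^ #T ≤ 2 ^ #T * #(subsetSums A T) := by
  classical
  induction T using Finset.induction_on with
  | empty => simp [subsetSums]
  | insert i T hi ih =>
    have ih := ih (fun j hj => hA j (mem_insert_of_mem hj))
      (fun F hF => hT F (hF.trans (subset_insert _ _)))
    have hmem : ∀ x ∈ subsetSums A (insert i T), t + x ∈ S := by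
      intro x hx
      obtain ⟨F, hF, rfl⟩ := mem_subsetSums.1 hx
      exact hT F hF
    have key : 3 * #(subsetSums A T) ≤ 2 * #(subsetSums A (insert i T)) := by
      refine three_mul_card_le_of_add_mem (a := A i) ?_ ?_ ?_
      · exact image_subset_image (powerset_mono.2 (subset_insert _ _))
      · intro x hx
        obtain ⟨F, hF, rfl⟩ := mem_subsetSums.1 hx
        refine mem_subsetSums.2 ⟨insert i F, insert_subset_insert _ hF, ?_⟩
        rw [sum_insert fun h => hi (hF h), add_comm]
      · intro x h0 h1 h2 h3
        refine hS (t + x) (A i) (hA i (mem_insert_self _ _)) (hmem _ h0) ?_ ?_ ?_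
        · simpa only [add_assoc] using hmem _ h1
        · simpa only [add_assoc] using hmem _ h2
        · simpa only [add_assoc] using hmem _ h3
    rw [card_insert_of_notMem hi, pow_succ, pow_succ]
    calc 3 ^ #T * 3 ≤ 2 ^ #T * #(subsetSums A T) * 3 := Nat.mul_le_mul_right _ ih
      _ = 2 ^ #T * (3 * #(subsetSums A T)) := by ring
      _ ≤ 2 ^ #T * (2 * #(subsetSums A (insert i T))) := Nat.mul_le_mul_left _ key
      _ = _ := by ring

section QuadraticChar

variable {F : Type*} [Field F] [Fintype F] [DecidableEq F]

theorem sum_quadraticChar_mul_shift (hF : ringChar F ≠ 2) {h : F} (hh : h ≠ 0) :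
    ∑ x : F, quadraticChar F x * quadraticChar F (x + h) = -1 := by
  have h1 : ∀ x : F, x ≠ 0 → quadraticChar F x * quadraticChar F (x + h) =
      quadraticChar F (1 + h * x⁻¹) := by
    intro x hx
    rw [← map_mul, show x * (x + h) = x ^ 2 * (1 + h * x⁻¹) by field_simp, map_mul,
      quadraticChar_sq_one' hx, one_mul]
  have h2 : ∑ x : F, quadraticChar F (1 + h * x⁻¹) = 0 := by
    rw [← quadraticChar_sum_zero hF]
    refine Fintype.sum_bijective (fun x : F => 1 + h * x⁻¹) ?_ _ _ fun _ => rfl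
    exact (AddGroup.addLeft_bijective 1).comp
      ((mulLeft_bijective₀ h hh).comp inv_involutive.bijective)
  have h3 : ∀ x : F, quadraticChar F x * quadraticChar F (x + h) =
      quadraticChar F (1 + h * x⁻¹) - if x = 0 then 1 else 0 := by
    intro x
    split_ifs with hx
    · simp [hx]
    · rw [h1 x hx, sub_zero]
  rw [Finset.sum_congr rfl fun x _ => h3 x, Finset.sum_sub_distrib, h2]
  simp

theorem sum_quadraticChar_mul_le (hF : ringChar F ≠ 2) (b b' : F) :
    ∑ x : F, quadraticChar F (x + b) * quadraticChar F (x + b') ≤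
      if b = b' then (Fintype.card F : ℤ) else 0 := by
  split_ifs with h
  · subst h
    calc _ ≤ ∑ _x : F, (1 : ℤ) := Finset.sum_le_sum fun x _ => by
          rw [← sq]
          by_cases h : x + b = 0
          · simp [h]
          · rw [quadraticChar_sq_one h]
      _ = _ := by simp
  · have := sum_quadraticChar_mul_shift hF (sub_ne_zero.2 (Ne.symm h))
    have h2 : ∑ x : F, quadraticChar F (x + b) * quadraticChar F (x + b') = -1 := by
      rw [← this]
      refine Fintype.sum_equiv (Equiv.addRight b) _ _ fun x => ?_
      simp
    rw [h2]
    norm_num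

open Finset in
/-- If all sums `x + y` with `x ∈ A`, `y ∈ B` are squares, then `|A| |B|` is at most `4 |F|`. -/
theorem card_mul_card_le_of_isSquare_add (hF : ringChar F ≠ 2) {A B : Finset F}
    (h : ∀ x ∈ A, ∀ y ∈ B, IsSquare (x + y)) : #A * #B ≤ 4 * Fintype.card F := by
  have hcorr : ∑ x : F, (∑ b ∈ B, quadraticChar F (x + b)) ^ 2 ≤ Fintype.card F * #B := by
    calc _ = ∑ b ∈ B, ∑ b' ∈ B, ∑ x : F, quadraticChar F (x + b) * quadraticChar F (x + b') := by
          simp_rw [sq, sum_mul_sum]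
          rw [sum_comm]
          exact sum_congr rfl fun b _ => sum_comm
      _ ≤ ∑ b ∈ B, ∑ b' ∈ B, if b = b' then (Fintype.card F : ℤ) else 0 :=
          sum_le_sum fun b _ => sum_le_sum fun b' _ => sum_quadraticChar_mul_le hF b b'
      _ = _ := by
          rw [sum_congr rfl fun b hb => by rw [sum_ite_eq, if_pos hb]]
          simp [mul_comm]
  have hone : ∀ x ∈ A, (#B : ℤ) - 1 ≤ ∑ b ∈ B, quadraticChar F (x + b) := by
    intro x hx
    calc (#B : ℤ) - 1 ≤ ∑ b ∈ B, (1 - if b = -x then 1 else 0) := by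
          rw [sum_sub_distrib, sum_ite_eq']
          split_ifs <;> simp
      _ ≤ _ := sum_le_sum fun b hb => by
          split_ifs with hbx
          · simp [hbx]
          · have hne : x + b ≠ 0 := fun h0 => hbx (eq_neg_of_add_eq_zero_right h0)
            rw [(quadraticChar_one_iff_isSquare hne).2 (h x hx b hb)]
            simp
  rcases Nat.lt_or_ge #B 2 with hB | hB
  · have := card_le_univ A
    nlinarith
  · have h2 : (#A : ℤ) * (#B - 1) ^ 2 ≤ Fintype.card F * #B := by
      refine le_trans ?_ hcorr
      calc (#A : ℤ) * (#B - 1) ^ 2 = ∑ x ∈ A, ((#B : ℤ) - 1) ^ 2 := by simp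
        _ ≤ ∑ x ∈ A, (∑ b ∈ B, quadraticChar F (x + b)) ^ 2 := sum_le_sum fun x hx => by
            refine pow_le_pow_left₀ ?_ (hone x hx) 2
            have : (2 : ℤ) ≤ #B := by exact_mod_cast hB
            linarith
        _ ≤ _ := sum_le_sum_of_subset_of_nonneg (subset_univ _) fun _ _ _ => sq_nonneg _
    have hB' : (2 : ℤ) ≤ #B := by exact_mod_cast hB
    have h3 : ((#B : ℤ)) ^ 2 ≤ 4 * (#B - 1) ^ 2 := by nlinarith
    have h4 : ((#A : ℤ) * #B) * #B ≤ (4 * Fintype.card F) * #B := by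
      have := mul_le_mul_of_nonneg_left h3 (Nat.cast_nonneg (α := ℤ) #A)
      linarith
    exact_mod_cast le_of_mul_le_mul_right h4 (by linarith)

end QuadraticChar

open Finset in
theorem sq_card_le_card_image_mul {α β : Type*} [DecidableEq α] [DecidableEq β] (s : Finset α)
    (f : α → β) : #s ^ 2 ≤ #(s.image f) * (#{x ∈ s.offDiag | f x.1 = f x.2} + #s) := by
  have h1 : #{x ∈ s ×ˢ s | f x.1 = f x.2} = ∑ c ∈ s.image f, #{x ∈ s | f x = c} ^ 2 := by
    rw [card_eq_sum_card_fiberwise (f := fun x => f x.1) (t := s.image f)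
      (by intro x hx; simp at hx ⊢; exact ⟨_, hx.1.1, rfl⟩)]
    refine sum_congr rfl fun c _ => ?_
    rw [sq, ← card_product]
    congr 1
    ext ⟨x, y⟩
    simp only [mem_filter, mem_product]
    grind
  have h2 : #{x ∈ s ×ˢ s | f x.1 = f x.2} ≤ #{x ∈ s.offDiag | f x.1 = f x.2} + #s := by
    rw [← diag_union_offDiag, filter_union, add_comm]
    refine (card_union_le _ _).trans (Nat.add_le_add_right ((card_filter_le _ _).trans ?_) _)
    rw [diag_card]
  calc #s ^ 2 = (∑ c ∈ s.image f, #{x ∈ s | f x = c}) ^ 2 := by rw [← card_eq_sum_card_image]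
    _ ≤ #(s.image f) * ∑ c ∈ s.image f, #{x ∈ s | f x = c} ^ 2 := sq_sum_le_card_mul_sum_sq
    _ ≤ _ := Nat.mul_le_mul_left _ (h1 ▸ h2)

open Finset in
theorem card_filter_prime_dvd_sub_le {P : Finset ℕ} (hP : ∀ p ∈ P, p.Prime) {x y N : ℕ}
    (hxy : x ≠ y) (hx : x ≤ N) (hy : y ≤ N) :
    #(P.filter fun p : ℕ => (p : ℤ) ∣ (x : ℤ) - y) ≤ Nat.log 2 N := by
  wlog h : y < x generalizing x y
  · simpa only [dvd_sub_comm] using this hxy.symm hy hx (by omega)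
  have hdvd : ∏ p ∈ P.filter fun p : ℕ => (p : ℤ) ∣ (x : ℤ) - y, p ∣ x - y := by
    refine Finset.prod_primes_dvd _ (fun p hp => (hP p (mem_filter.1 hp).1).prime) fun p hp => ?_
    have := (mem_filter.1 hp).2
    rwa [← Nat.cast_sub h.le, Int.natCast_dvd_natCast] at this
  have hle := Nat.le_of_dvd (Nat.sub_pos_of_lt h) hdvd
  have hpow : 2 ^ #(P.filter fun p : ℕ => (p : ℤ) ∣ (x : ℤ) - y) ≤
      ∏ p ∈ P.filter fun p : ℕ => (p : ℤ) ∣ (x : ℤ) - y, p :=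
    pow_card_le_prod _ _ _ fun p hp => (hP p (mem_filter.1 hp).1).two_le
  exact Nat.le_log_of_pow_le one_lt_two (by omega)

open Finset in
theorem sum_card_offDiag_dvd_sub_le {P : Finset ℕ} (hP : ∀ p ∈ P, p.Prime) {A : Finset ℕ} {N : ℕ}
    (hA : ∀ x ∈ A, x ≤ N) :
    ∑ p ∈ P, #{x ∈ A.offDiag | (p : ℤ) ∣ (x.1 : ℤ) - x.2} ≤ #A ^ 2 * Nat.log 2 N := by
  calc _ = ∑ x ∈ A.offDiag, #(P.filter fun p : ℕ => (p : ℤ) ∣ (x.1 : ℤ) - x.2) :=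
        sum_card_bipartiteAbove_eq_sum_card_bipartiteBelow
          fun (p : ℕ) (x : ℕ × ℕ) => (p : ℤ) ∣ (x.1 : ℤ) - x.2
    _ ≤ ∑ x ∈ A.offDiag, Nat.log 2 N := sum_le_sum fun x hx => by
        obtain ⟨h1, h2, h3⟩ := mem_offDiag.1 hx
        exact card_filter_prime_dvd_sub_le hP h3 (hA _ h1) (hA _ h2)
    _ ≤ _ := by
        rw [sum_const, smul_eq_mul, offDiag_card, sq]
        exact Nat.mul_le_mul_right _ (Nat.sub_le _ _)

open Finset in
/-- A larger sieve for sumsets in an affine image of the squares. -/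
theorem card_primes_le_of_add_square {A B P : Finset ℕ} {K N : ℕ} {α β : ℤ} (hK : 0 < K)
    (hAK : 4 * K ≤ #A) (hBK : 4 * K ≤ #B) (hAN : ∀ x ∈ A, x ≤ N) (hBN : ∀ x ∈ B, x ≤ N)
    (hsq : ∀ x ∈ A, ∀ y ∈ B, IsSquare (α * (x + y) + β))
    (hP : ∀ p ∈ P, p.Prime ∧ p ≠ 2 ∧ ¬ (p : ℤ) ∣ α ∧ p ≤ K ^ 2) :
    #P ≤ 8 * K * Nat.log 2 N := by
  obtain ⟨A', hA', hAc⟩ := exists_subset_card_eq hAK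
  obtain ⟨B', hB', hBc⟩ := exists_subset_card_eq hBK
  have main : ∀ p ∈ P, 4 * K ≤ #{x ∈ A'.offDiag | (p : ℤ) ∣ (x.1 : ℤ) - x.2} +
      #{x ∈ B'.offDiag | (p : ℤ) ∣ (x.1 : ℤ) - x.2} := by
    intro p hp
    obtain ⟨hpp, hp2, hpα, hpK⟩ := hP p hp
    have := Fact.mk hpp
    have hα : (α : ZMod p) ≠ 0 := by rwa [ne_eq, ZMod.intCast_zmod_eq_zero_iff_dvd]
    have hcol : ∀ (s : Finset ℕ) (γ : ZMod p), {x ∈ s.offDiag | (p : ℤ) ∣ (x.1 : ℤ) - x.2} =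
        {x ∈ s.offDiag | α * (x.1 : ZMod p) + γ = α * x.2 + γ} := by
      intro s γ
      refine filter_congr fun x _ => ?_
      rw [← ZMod.intCast_zmod_eq_zero_iff_dvd, add_left_inj, mul_right_inj' hα]
      push_cast
      rw [sub_eq_zero]
    have hcard := card_mul_card_le_of_isSquare_add (F := ZMod p)
      (A := A'.image fun x : ℕ => α * (x : ZMod p) + β)
      (B := B'.image fun x : ℕ => α * (x : ZMod p) + 0)
      (by rwa [ZMod.ringChar_zmod_n]) (by
        intro x hx y hy
        obtain ⟨x, hxA, rfl⟩ := mem_image.1 hx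
        obtain ⟨y, hyB, rfl⟩ := mem_image.1 hy
        have := (hsq x (hA' hxA) y (hB' hyB)).map (Int.castRingHom (ZMod p))
        rw [eq_intCast] at this
        rwa [show α * (x : ZMod p) + β + (α * (y : ZMod p) + 0) =
          ((α * (x + y) + β : ℤ) : ZMod p) by push_cast; ring])
    rw [ZMod.card] at hcard
    have hA2 := sq_card_le_card_image_mul A' fun x : ℕ => α * (x : ZMod p) + β
    have hB2 := sq_card_le_card_image_mul B' fun x : ℕ => α * (x : ZMod p) + 0
    rw [← hcol A' β, hAc] at hA2
    rw [← hcol B' 0, hBc] at hB2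
    generalize #(A'.image fun x : ℕ => α * (x : ZMod p) + β) = m at *
    generalize #(B'.image fun x : ℕ => α * (x : ZMod p) + 0) = n at *
    have hmn : m ≤ 2 * K ∨ n ≤ 2 * K := by
      by_contra! h
      have := Nat.mul_lt_mul'' h.1 h.2
      nlinarith
    have fin : ∀ m r : ℕ, m ≤ 2 * K → (4 * K) ^ 2 ≤ m * (r + 4 * K) → 4 * K ≤ r := by
      intro m r hm h
      have := h.trans (Nat.mul_le_mul_right _ hm)
      nlinarith
    rcases hmn with h | h
    · exact (fin _ _ h hA2).trans (Nat.le_add_right _ _)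
    · exact (fin _ _ h hB2).trans (Nat.le_add_left _ _)
  have hsum := sum_le_sum main
  rw [sum_add_distrib, sum_const, smul_eq_mul] at hsum
  have h1 := sum_card_offDiag_dvd_sub_le (fun p hp => (hP p hp).1) fun x hx => hAN x (hA' hx)
  have h2 := sum_card_offDiag_dvd_sub_le (fun p hp => (hP p hp).1) fun x hx => hBN x (hB' hx)
  rw [hAc] at h1
  rw [hBc] at h2
  have : (4 * K) * #P ≤ (4 * K) * (8 * K * Nat.log 2 N) := by nlinarith
  exact le_of_mul_le_mul_left this (by omega)

open Filter
open scoped Nat.Prime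
theorem two_fifths_le : (2 / 5 : ℝ) ≤ Real.log (3 / 2) := by
  rw [Real.le_log_iff_exp_le (by norm_num)]
  have h : Real.exp (2/5) ^ 5 ≤ (3 / 2 : ℝ) ^ 5 := by
    rw [← Real.exp_nat_mul, show ((5 : ℕ) : ℝ) * (2 / 5) = 1 + 1 by norm_num, Real.exp_add]
    have := Real.exp_one_lt_d9
    have := Real.exp_pos 1
    nlinarith
  exact le_of_pow_le_pow_left₀ (by norm_num) (by norm_num) h

theorem eventually_rpow_le_primeCounting :
    ∀ᶠ n : ℕ in atTop, (n : ℝ) ^ (19 / 20 : ℝ) ≤ π n := by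
  have h1 := (isLittleO_log_rpow_atTop (r := 1 / 20) (by norm_num)).bound (c := 1 / 2) (by norm_num)
  have h2 := Real.isLittleO_log_id_atTop.bound (c := 1 / 20) (by norm_num)
  have h2' := (tendsto_atTop_add_const_right atTop (1 : ℝ) tendsto_id).eventually h2
  filter_upwards [tendsto_natCast_atTop_atTop.eventually h1,
    tendsto_natCast_atTop_atTop.eventually h2', eventually_ge_atTop 2] with n hn1 hn2 hn
  have hn' : (2 : ℝ) ≤ n := by exact_mod_cast hn
  have hlog : 0 < Real.log n := Real.log_pos (by linarith)
  have hlog' : 0 < Real.log (n + 1) := Real.log_pos (by linarith)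
  simp only [id, Real.norm_eq_abs, abs_of_pos hlog, abs_of_pos hlog',
    abs_of_nonneg (Real.rpow_nonneg (Nat.cast_nonneg n) _)] at hn1 hn2
  rw [abs_of_pos (by linarith)] at hn2
  refine le_trans ?_ (Chebyshev.pi_ge n)
  rw [le_div_iff₀ hlog]
  have h3 : (n : ℝ) ^ (19 / 20 : ℝ) * (n : ℝ) ^ (1 / 20 : ℝ) = n := by
    rw [← Real.rpow_add (by linarith)]
    norm_num
  have h4 := mul_le_mul_of_nonneg_left hn1 (Real.rpow_nonneg (Nat.cast_nonneg n) (19 / 20 : ℝ))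
  have h5 := Real.log_two_gt_d9
  nlinarith

/-- The primes up to `K²` eventually outnumber the bound given by the larger sieve. -/
theorem eventually_lt_primeCounting_sq (M : ℝ) :
    ∀ᶠ K : ℕ in atTop, 16 * K * ((K : ℝ) + 1) ^ (4 / 5 : ℝ) + M < π (K ^ 2) := by
  have h1 := (tendsto_pow_atTop (two_ne_zero)).eventually eventually_rpow_le_primeCounting
  have h2 := (tendsto_rpow_atTop (y := 1 / 10) (by norm_num)).eventually_ge_atTop 64
  have h3 := (tendsto_rpow_atTop (y := 19 / 10) (by norm_num)).eventually_gt_atTop (2 * M)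
  filter_upwards [h1, tendsto_natCast_atTop_atTop.eventually h2,
    tendsto_natCast_atTop_atTop.eventually h3, eventually_ge_atTop 1] with K hK1 hK2 hK3 hK
  have hK' : (1 : ℝ) ≤ K := by exact_mod_cast hK
  rw [Nat.cast_pow, ← Real.rpow_natCast, ← Real.rpow_mul (by linarith)] at hK1
  norm_num at hK1
  have h4 : ((K : ℝ) + 1) ^ (4 / 5 : ℝ) ≤ 2 * (K : ℝ) ^ (4 / 5 : ℝ) := by
    calc ((K : ℝ) + 1) ^ (4 / 5 : ℝ) ≤ (2 * K) ^ (4 / 5 : ℝ) := by gcongr; linarith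
      _ = 2 ^ (4 / 5 : ℝ) * (K : ℝ) ^ (4 / 5 : ℝ) := Real.mul_rpow (by norm_num) (by linarith)
      _ ≤ _ := by
        gcongr
        exact (Real.rpow_le_rpow_of_exponent_le (by norm_num) (by norm_num)).trans_eq
          (Real.rpow_one 2)
  have h5 : (K : ℝ) * (K : ℝ) ^ (4 / 5 : ℝ) = (K : ℝ) ^ (9 / 5 : ℝ) := by
    rw [← Real.rpow_one_add' (by linarith) (by norm_num)]
    norm_num
  have h6 : (K : ℝ) ^ (1 / 10 : ℝ) * (K : ℝ) ^ (9 / 5 : ℝ) = (K : ℝ) ^ (19 / 10 : ℝ) := by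
    rw [← Real.rpow_add (by linarith)]
    norm_num
  have h7 := mul_le_mul_of_nonneg_right hK2 (Real.rpow_nonneg (Nat.cast_nonneg K) (9 / 5 : ℝ))
  have h8 := mul_le_mul_of_nonneg_left h4 (show (0 : ℝ) ≤ 16 * K by positivity)
  linarith

theorem not_four_values_arith_prog {a b c : ℤ} (ha : 0 < a) (x e : ℕ) (he : 0 < e) :
    x ∈ {n : ℕ | ∃ z : ℤ, (n : ℤ) = a * z ^ 2 + b * z + c} →
    x + e ∈ {n : ℕ | ∃ z : ℤ, (n : ℤ) = a * z ^ 2 + b * z + c} →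
    x + 2 * e ∈ {n : ℕ | ∃ z : ℤ, (n : ℤ) = a * z ^ 2 + b * z + c} →
    x + 3 * e ∉ {n : ℕ | ∃ z : ℤ, (n : ℤ) = a * z ^ 2 + b * z + c} := by
  rintro ⟨z₀, h0⟩ ⟨z₁, h1⟩ ⟨z₂, h2⟩ ⟨z₃, h3⟩
  push_cast at h1 h2 h3
  have := eq_zero_of_four_squares_arith_prog (t := 4 * a * x + (b ^ 2 - 4 * a * c)) (d := 4 * a * e)
    (w := 2 * a * z₀ + b) (x := 2 * a * z₁ + b) (y := 2 * a * z₂ + b) (z := 2 * a * z₃ + b)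
    (by linear_combination 4 * a * h0) (by linear_combination 4 * a * h1)
    (by linear_combination 4 * a * h2) (by linear_combination 4 * a * h3)
  have h4 : 0 < 4 * a * (e : ℤ) := by positivity
  omega

open Finset in
/-- Removing the primes dividing a nonzero `α`, and `2`, removes few primes. -/
theorem primeCounting_le_card_filter_add {α : ℤ} (hα : 1 < α) (n : ℕ) :
    π n ≤ #((Nat.primesLE n).filter fun p : ℕ => p ≠ 2 ∧ ¬ (p : ℤ) ∣ α) + (α.toNat + 1) := by
  rw [← Nat.primesLE_card_eq_primeCounting,
    ← card_filter_add_card_filter_not (s := Nat.primesLE n)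
      fun p : ℕ => p ≠ 2 ∧ ¬ (p : ℤ) ∣ α]
  gcongr
  calc _ ≤ #(range (α.toNat + 1)) := card_le_card fun p hp => by
        simp only [mem_filter, not_and_or, not_not] at hp
        rw [mem_range]
        rcases hp.2 with rfl | h
        · omega
        · have := Int.le_of_dvd (by omega) h
          omega
    _ = _ := card_range _

open Finset in
theorem four_mul_le_card_subsetSums {ι : Type*} {A : ι → ℕ} {T : Finset ι} {S : Set ℕ}
    (hS : ∀ x a, 0 < a → x ∈ S → x + a ∈ S → x + 2 * a ∈ S → x + 3 * a ∉ S)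
    (hA : ∀ i, 0 < A i) {t : ℕ} (hT : ∀ F ⊆ T, t + ∑ i ∈ F, A i ∈ S) {K : ℕ}
    (hK : (4 * K : ℝ) ≤ (3 / 2) ^ #T) : 4 * K ≤ #(subsetSums A T) := by
  have h1 := three_pow_le_card_subsetSums hS (fun i _ => hA i) hT
  have h2 : (3 : ℝ) ^ #T ≤ 2 ^ #T * #(subsetSums A T) := by exact_mod_cast h1
  rw [div_pow, le_div_iff₀ (by positivity)] at hK
  have h3 : (2 : ℝ) ^ #T * (4 * K) ≤ 2 ^ #T * #(subsetSums A T) := by linarith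
  exact_mod_cast le_of_mul_le_mul_left h3 (by positivity)

open Finset in
/-- A cube of dimension at least `2s + 1` in the values of a quadratic polynomial, when `(3/2)^s`
is at least `4K`, forces a bound on the number of primes up to `K²`. -/
theorem primeCounting_sq_le_of_cube {a b c : ℤ} (ha : 0 < a) {N d a₀ s K : ℕ} {A : Fin d → ℕ}
    (hA : ∀ i, 0 < A i)
    (hH : ∀ F : Finset (Fin d), F.Nonempty →
      (∃ x : ℤ, ((a₀ + ∑ i ∈ F, A i : ℕ) : ℤ) = a * x ^ 2 + b * x + c) ∧ a₀ + ∑ i ∈ F, A i ≤ N)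
    (hsd : 2 * s + 1 ≤ d) (hK : 0 < K) (hKs : (4 * K : ℝ) ≤ (3 / 2) ^ s) :
    π (K ^ 2) ≤ 8 * K * Nat.log 2 N + ((4 * a).toNat + 1) := by
  let i₀ : Fin d := ⟨0, by omega⟩
  obtain ⟨T, hT, hTs⟩ := exists_subset_card_eq (s := univ.erase i₀) (n := s + s) (by
    rw [card_erase_of_mem (mem_univ _), card_univ, Fintype.card_fin]; omega)
  obtain ⟨T₁, hT₁, hT₁s⟩ := exists_subset_card_eq (s := T) (n := s) (by omega)
  have hT₂s : #(T \ T₁) = s := by rw [card_sdiff_of_subset hT₁]; omega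
  have hsum : ∀ F₁ ⊆ T₁, ∀ F₂ ⊆ T \ T₁, ∑ i ∈ insert i₀ (F₁ ∪ F₂), A i =
      A i₀ + (∑ i ∈ F₁, A i + ∑ i ∈ F₂, A i) := by
    intro F₁ hF₁ F₂ hF₂
    have hdisj : Disjoint F₁ F₂ :=
      disjoint_of_subset_left hF₁ (disjoint_of_subset_right hF₂ disjoint_sdiff)
    rw [sum_insert, sum_union hdisj]
    intro h
    have hU : F₁ ∪ F₂ ⊆ T := union_subset (hF₁.trans hT₁) (hF₂.trans sdiff_subset)
    exact (mem_erase.1 (hT (hU h))).1 rfl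
  have hcube : ∀ F₁ ⊆ T₁, ∀ F₂ ⊆ T \ T₁,
      (∃ x : ℤ, ((a₀ + A i₀ + (∑ i ∈ F₁, A i + ∑ i ∈ F₂, A i) : ℕ) : ℤ) = a * x ^ 2 + b * x + c) ∧
      a₀ + A i₀ + (∑ i ∈ F₁, A i + ∑ i ∈ F₂, A i) ≤ N := by
    intro F₁ hF₁ F₂ hF₂
    have := hH (insert i₀ (F₁ ∪ F₂)) (insert_nonempty _ _)
    rwa [hsum F₁ hF₁ F₂ hF₂, ← add_assoc] at this
  refine (primeCounting_le_card_filter_add (α := 4 * a) (by omega) _).trans ?_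
  gcongr
  refine card_primes_le_of_add_square (A := subsetSums A T₁) (B := subsetSums A (T \ T₁))
    (α := 4 * a) (β := 4 * a * (a₀ + A i₀) + (b ^ 2 - 4 * a * c)) hK ?_ ?_ ?_ ?_ ?_ ?_
  · refine four_mul_le_card_subsetSums (not_four_values_arith_prog (b := b) (c := c) ha) hA
      (t := a₀ + A i₀) ?_ (hT₁s ▸ hKs)
    intro F hF
    simpa using (hcube F hF ∅ (empty_subset _)).1
  · refine four_mul_le_card_subsetSums (not_four_values_arith_prog (b := b) (c := c) ha) hA
      (t := a₀ + A i₀) ?_ (hT₂s ▸ hKs)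
    intro F hF
    simpa using (hcube ∅ (empty_subset _) F hF).1
  · intro x hx
    obtain ⟨F, hF, rfl⟩ := mem_subsetSums.1 hx
    have := (hcube F hF ∅ (empty_subset _)).2
    omega
  · intro x hx
    obtain ⟨F, hF, rfl⟩ := mem_subsetSums.1 hx
    have := (hcube ∅ (empty_subset _) F hF).2
    omega
  · intro x hx y hy
    obtain ⟨F₁, hF₁, rfl⟩ := mem_subsetSums.1 hx
    obtain ⟨F₂, hF₂, rfl⟩ := mem_subsetSums.1 hy
    obtain ⟨z, hz⟩ := (hcube F₁ hF₁ F₂ hF₂).1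
    rw [Nat.cast_add, Nat.cast_add, Nat.cast_add] at hz
    exact ⟨2 * a * z + b, by linear_combination 4 * a * hz⟩
  · intro p hp
    obtain ⟨h1, h2, h3⟩ := mem_filter.1 hp
    obtain ⟨h4, h5⟩ := Nat.mem_primesLE.1 h1
    exact ⟨h5, h2, h3, h4⟩

/-- Hilbert cubes in the values of a quadratic polynomial `f(x) = ax² + bx + c`
with `a > 0` and `4a + b² - 4ac ≥ 1`. -/
theorem stmt_1 (a b c : ℤ) (ha : 0 < a) (hdisc : 1 ≤ 4 * a + b ^ 2 - 4 * a * c) :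
    ∃ N₀ : ℕ, ∀ N : ℕ, N₀ ≤ N →
      ∀ (d : ℕ) (a₀ : ℕ) (A : Fin d → ℕ),
        (∀ i, 0 < A i) →
        (∀ F : Finset (Fin d), (a₀ = 0 → F.Nonempty) →
          (∃ x : ℤ, ((a₀ + ∑ i ∈ F, A i : ℕ) : ℤ) = a * x ^ 2 + b * x + c) ∧
          1 ≤ a₀ + ∑ i ∈ F, A i ∧ a₀ + ∑ i ∈ F, A i ≤ N) →
        (d : ℝ) ≤ 7 * Real.log (Real.log N) := by
  have hlog : Tendsto (fun N : ℕ => Real.log N) atTop atTop :=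
    Real.tendsto_log_atTop.comp tendsto_natCast_atTop_atTop
  have hfloor : Tendsto (fun N : ℕ => ⌊Real.log N ^ (5 / 4 : ℝ)⌋₊) atTop atTop :=
    tendsto_nat_floor_atTop.comp ((tendsto_rpow_atTop (by norm_num)).comp hlog)
  have h1 := hfloor.eventually (eventually_lt_primeCounting_sq ((4 * a).toNat + 1))
  have h2 := hfloor.eventually (eventually_gt_atTop 0)
  have h3 := hlog.eventually ((tendsto_rpow_atTop (y := 3 / 20) (by norm_num)).eventually_ge_atTop 6)
  have h4 := hlog.eventually (eventually_gt_atTop (Real.exp 1))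
  obtain ⟨N₀, hN₀⟩ := eventually_atTop.1 (h1.and (h2.and (h3.and h4)))
  refine ⟨N₀, fun N hN d a₀ A hA hH => ?_⟩
  obtain ⟨h1, h2, h3, h4⟩ := hN₀ N hN
  clear hN₀ hlog hfloor
  by_contra! hd
  set L := Real.log N with hL
  set K := ⌊L ^ (5 / 4 : ℝ)⌋₊ with hKdef
  have hL1 : 1 < Real.log L := (Real.lt_log_iff_exp_lt ((Real.exp_pos 1).trans h4)).2 h4
  have hL0 : 0 < L := (Real.exp_pos 1).trans h4
  have hd7 : 7 < d := by
    have : (7 : ℝ) < d := by linarith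
    exact_mod_cast this
  obtain ⟨s, hs⟩ : ∃ s, d = 2 * s + 1 ∨ d = 2 * s + 2 := ⟨(d - 1) / 2, by omega⟩
  have hKs : (4 * K : ℝ) ≤ (3 / 2) ^ s := by
    have hs1 : (7 / 2) * Real.log L ≤ s + 1 := by
      have : (d : ℝ) ≤ 2 * s + 2 := by exact_mod_cast (show d ≤ 2 * s + 2 by omega)
      linarith
    have hpow : L ^ (7 / 5 : ℝ) ≤ (3 / 2) ^ (s + 1) := by
      rw [← Real.rpow_natCast, Real.rpow_def_of_pos hL0, Real.rpow_def_of_pos (by norm_num),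
        Real.exp_le_exp]
      push_cast
      nlinarith [two_fifths_le]
    have hsplit : L ^ (7 / 5 : ℝ) = L ^ (3 / 20 : ℝ) * L ^ (5 / 4 : ℝ) := by
      rw [← Real.rpow_add hL0]
      norm_num
    have hKL : (K : ℝ) ≤ L ^ (5 / 4 : ℝ) := Nat.floor_le (by positivity)
    rw [pow_succ] at hpow
    have := mul_le_mul_of_nonneg_right h3 (show 0 ≤ L ^ (5 / 4 : ℝ) by positivity)
    linarith
  have hmain := primeCounting_sq_le_of_cube ha hA
    (fun F hF => ⟨(hH F fun _ => hF).1, (hH F fun _ => hF).2.2⟩) (by omega) h2 hKs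
  have hLK : L ≤ ((K : ℝ) + 1) ^ (4 / 5 : ℝ) := by
    calc L = (L ^ (5 / 4 : ℝ)) ^ (4 / 5 : ℝ) := by
          rw [← Real.rpow_mul hL0.le]
          norm_num
      _ ≤ _ := Real.rpow_le_rpow (by positivity) (Nat.lt_floor_add_one _).le (by norm_num)
  have hlog2 : (Nat.log 2 N : ℝ) ≤ 2 * L := by
    have hN0 : N ≠ 0 := by
      rintro rfl
      simp [hL] at hL0
    have hp : ((2 : ℝ) ^ Nat.log 2 N) ≤ N := by exact_mod_cast Nat.pow_log_le_self 2 hN0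
    have := Real.log_le_log (by positivity) hp
    rw [Real.log_pow] at this
    have := Real.log_two_gt_d9
    have : (0 : ℝ) ≤ Nat.log 2 N := Nat.cast_nonneg _
    nlinarith
  have hmain' : (π (K ^ 2) : ℝ) ≤ 8 * K * Nat.log 2 N + ((4 * a).toNat + 1) := by
    exact_mod_cast hmain
  have : (8 * K * Nat.log 2 N : ℝ) ≤ 16 * K * ((K : ℝ) + 1) ^ (4 / 5 : ℝ) := by
    have hK0 : (0 : ℝ) ≤ 8 * K := by positivity
    have := mul_le_mul_of_nonneg_left (hlog2.trans (mul_le_mul_of_nonneg_left hLK zero_le_two)) hK0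
    linarith
  linarith
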